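/- Let Φ = {φ_a}_{a∈A} be an equicontractive IFS on ℝ^d (all contraction ratios equal: r_a = r for all a ∈ A), with attractor X, coding map π, similarity dimension dim_S(Φ) = log(#A)/(−log r), and self-similar measure μ. Let g : ℕ → [0,∞) be any function and set Ψ(a) := diam(X_a)·g(|a|). If Σ_{n=1}^∞ Σ_{a∈A^n} n·(diam(X_a)·g(n))^{dim_S(Φ)} = ∞, then μ(W_Φ(Ψ)) = 1. -/

import Mathlib

open MeasureTheory Filter Metric Set

noncomputable section

/-- The composition `φ_{a_1} ∘ ⋯ ∘ φ_{a_n}` associated to a finite word `a ∈ A^n`. -/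
def iterMap {A E : Type*} (φ : A → E → E) : {n : ℕ} → (Fin n → A) → E → E :=
  fun a => (List.ofFn (fun i => φ (a i))).foldr (· ∘ ·) id

/-- The eventually periodic sequence `a_1⋯a_l (a_{l+1}⋯a_n)^∞` with preperiod `a_1⋯a_l`
and period `a_{l+1}⋯a_n`. -/
def evp {A : Type*} {n : ℕ} (a : Fin n → A) (l : ℕ) (h : l < n) : ℕ → A := fun i =>
  if hi : i < l then a ⟨i, hi.trans h⟩
  else a ⟨l + (i - l) % (n - l), by
    have h1 : (i - l) % (n - l) < n - l := Nat.mod_lt _ (by omega)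
    omega⟩

/-- The limsup set `W_Φ(Ψ)`: points `x` such that for infinitely many `n` there are
`a ∈ A^n` and `0 ≤ l ≤ n-1` with `‖x - π(a_1⋯a_l(a_{l+1}⋯a_n)^∞)‖ < Ψ(a)`. -/
def limsupW {A : Type*} {d : ℕ} (π : (ℕ → A) → EuclideanSpace ℝ (Fin d))
    (Ψ : (n : ℕ) → (Fin n → A) → ℝ) : Set (EuclideanSpace ℝ (Fin d)) :=
  {x | ∃ᶠ n in atTop, ∃ a : Fin n → A, ∃ l : ℕ, ∃ h : l < n,
    ‖x - π (evp a l h)‖ < Ψ n a}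

/-- The cylinder set `[a]` of sequences starting with the word `a`. -/
def cyl {A : Type*} {n : ℕ} (a : Fin n → A) : Set (ℕ → A) := {σ | ∀ i : Fin n, σ i = a i}

/-- Sequences satisfying the coincidences `σ j = σ (f j)` for all `j ∈ J`. -/
def coincide {A : Type*} (J : Finset ℕ) (f : ℕ → ℕ) : Set (ℕ → A) := {σ | ∀ j ∈ J, σ j = σ (f j)}

lemma card_coincide_words {A : Type*} [Fintype A] (J : Finset ℕ) (f : ℕ → ℕ)
    (hf : ∀ j ∈ J, f j < j) (M : ℕ) :
    Nat.card {a : Fin M → A // ∀ j i : Fin M, (j : ℕ) ∈ J → (i : ℕ) = f j → a j = a i} *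
      Fintype.card A ^ (J.filter (· < M)).card = Fintype.card A ^ M := by
  induction M with
  | zero =>
    simp
  | succ M ih =>
    have snoc_iff : ∀ (b : Fin M → A) (x : A),
        (∀ j i : Fin (M + 1), (j : ℕ) ∈ J → (i : ℕ) = f j →
          (Fin.snoc b x : Fin (M + 1) → A) j = (Fin.snoc b x : Fin (M + 1) → A) i) ↔
        (∀ j i : Fin M, (j : ℕ) ∈ J → (i : ℕ) = f j → b j = b i) ∧
        (∀ i : Fin M, M ∈ J → (i : ℕ) = f M → x = b i) := by
      intro b x
      constructor
      · intro h
        refine ⟨fun j i hj hi => ?_, fun i hM hi => ?_⟩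
        · simpa using h j.castSucc i.castSucc hj hi
        · simpa using h (Fin.last M) i.castSucc hM hi
      · rintro ⟨h1, h2⟩ j i hj hi
        have hlt := hf _ hj
        induction i using Fin.lastCases with
        | last =>
          have := j.isLt
          simp only [Fin.val_last] at hi
          omega
        | cast i =>
          induction j using Fin.lastCases with
          | last => simpa using h2 i hj hi
          | cast j => simpa using h1 j i hj hi
    by_cases hM : M ∈ J
    · have e : {a : Fin (M + 1) → A //
            ∀ j i : Fin (M + 1), (j : ℕ) ∈ J → (i : ℕ) = f j → a j = a i} ≃
          {a : Fin M → A // ∀ j i : Fin M, (j : ℕ) ∈ J → (i : ℕ) = f j → a j = a i} :=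
        { toFun := fun a => ⟨Fin.init a.1, by
            have := a.2
            rw [← Fin.snoc_init_self a.1] at this
            exact ((snoc_iff _ _).1 this).1⟩
          invFun := fun b => ⟨Fin.snoc b.1 (b.1 ⟨f M, hf M hM⟩), by
            refine (snoc_iff _ _).2 ⟨b.2, fun i _ hi => ?_⟩
            exact congrArg b.1 (Fin.ext hi.symm)⟩
          left_inv := by
            intro a
            apply Subtype.ext
            have := a.2
            rw [← Fin.snoc_init_self a.1] at this
            have h2 := ((snoc_iff _ _).1 this).2 ⟨f M, hf M hM⟩ hM rfl
            simp only
            rw [← h2, Fin.snoc_init_self]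
          right_inv := by
            intro b
            apply Subtype.ext
            simp }
      have hc : J.filter (· < M + 1) = insert M (J.filter (· < M)) := by
        ext j
        simp only [Finset.mem_filter, Finset.mem_insert]
        constructor
        · rintro ⟨h1, h2⟩
          by_cases h : j = M
          · exact Or.inl h
          · exact Or.inr ⟨h1, by omega⟩
        · rintro (rfl | ⟨h1, h2⟩)
          · exact ⟨hM, by omega⟩
          · exact ⟨h1, by omega⟩
      rw [Nat.card_congr e, hc, Finset.card_insert_of_notMem (by simp), pow_succ, pow_succ, ← ih]
      ring
    · have e : {a : Fin (M + 1) → A //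
            ∀ j i : Fin (M + 1), (j : ℕ) ∈ J → (i : ℕ) = f j → a j = a i} ≃
          {a : Fin M → A // ∀ j i : Fin M, (j : ℕ) ∈ J → (i : ℕ) = f j → a j = a i} × A :=
        { toFun := fun a => (⟨Fin.init a.1, by
            have := a.2
            rw [← Fin.snoc_init_self a.1] at this
            exact ((snoc_iff _ _).1 this).1⟩, a.1 (Fin.last M))
          invFun := fun b => ⟨Fin.snoc b.1.1 b.2,
            (snoc_iff _ _).2 ⟨b.1.2, fun i h _ => absurd h hM⟩⟩
          left_inv := fun a => Subtype.ext (Fin.snoc_init_self a.1)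
          right_inv := by
            rintro ⟨b, x⟩
            simp }
      have hc : J.filter (· < M + 1) = J.filter (· < M) := by
        ext j
        simp only [Finset.mem_filter]
        constructor
        · rintro ⟨h1, h2⟩
          have : j ≠ M := fun h => hM (h ▸ h1)
          exact ⟨h1, by omega⟩
        · rintro ⟨h1, h2⟩
          exact ⟨h1, by omega⟩
      rw [Nat.card_congr e, hc, Nat.card_prod, pow_succ, ← ih, Nat.card_eq_fintype_card (α := A)]
      ring

lemma measurableSet_cyl {A : Type*} [MeasurableSpace A] [MeasurableSingletonClass A]
    {n : ℕ} (a : Fin n → A) : MeasurableSet (cyl a) := by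
  have : cyl a = ⋂ i : Fin n, (fun σ : ℕ → A => σ i) ⁻¹' {a i} := by
    ext σ
    simp [cyl]
  rw [this]
  exact MeasurableSet.iInter fun i => measurable_pi_apply _ (measurableSet_singleton _)

lemma measurableSet_coincide {A : Type*} [Finite A] [MeasurableSpace A]
    [MeasurableSingletonClass A] (J : Finset ℕ) (f : ℕ → ℕ) :
    MeasurableSet (coincide J f : Set (ℕ → A)) := by
  have : (coincide J f : Set (ℕ → A)) = ⋂ j ∈ J, {σ | σ j = σ (f j)} := by
    ext σ
    simp [coincide]
  rw [this]
  exact Finset.measurableSet_biInter _ fun j _ =>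
    measurableSet_eq_fun (measurable_pi_apply _) (measurable_pi_apply _)

/-- Under the uniform Bernoulli measure, the coincidences `σ j = σ (f j)`, `f j < j`, are
independent events of probability `1 / #A`. -/
lemma measure_coincide {A : Type*} [Fintype A] [MeasurableSpace A] [MeasurableSingletonClass A]
    (𝔪 : Measure (ℕ → A)) [IsProbabilityMeasure 𝔪]
    (hA : 0 < Fintype.card A)
    (h𝔪 : ∀ (n : ℕ) (a : Fin n → A), 𝔪.real (cyl a) = ((Fintype.card A : ℝ)⁻¹) ^ n)
    (J : Finset ℕ) (f : ℕ → ℕ) (hf : ∀ j ∈ J, f j < j) :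
    𝔪.real (coincide J f) = ((Fintype.card A : ℝ)⁻¹) ^ J.card := by
  classical
  obtain ⟨M, hM⟩ : ∃ M, ∀ j ∈ J, j < M := ⟨J.sup id + 1, fun j hj =>
    Nat.lt_succ_of_le (Finset.le_sup (f := id) hj)⟩
  set Q : (Fin M → A) → Prop := fun a =>
    ∀ j i : Fin M, (j : ℕ) ∈ J → (i : ℕ) = f j → a j = a i with hQ
  have hunion : (coincide J f : Set (ℕ → A)) =
      ⋃ a ∈ (Finset.univ.filter Q : Finset (Fin M → A)), cyl a := by
    ext σ
    simp only [Set.mem_iUnion, Finset.mem_filter, Finset.mem_univ, true_and, exists_prop]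
    constructor
    · intro h
      refine ⟨fun i => σ i, fun j i hj hi => ?_, fun i => rfl⟩
      simp only [hi]
      exact h _ hj
    · rintro ⟨a, ha, hσ⟩ j hj
      have h1 := hM j hj
      have h2 := hf j hj
      rw [hσ ⟨j, h1⟩, hσ ⟨f j, h2.trans h1⟩]
      exact ha ⟨j, h1⟩ ⟨f j, h2.trans h1⟩ hj rfl
  have hcard := card_coincide_words (A := A) J f hf M
  have hJ : J.filter (· < M) = J := Finset.filter_true_of_mem hM
  have hcQ : Nat.card {a : Fin M → A // Q a} = (Finset.univ.filter Q).card := by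
    rw [Nat.card_eq_fintype_card, Fintype.card_subtype]
  rw [hJ] at hcard
  change Nat.card {a : Fin M → A // Q a} * _ = _ at hcard
  rw [hcQ] at hcard
  rw [hunion, measureReal_biUnion_finset]
  · rw [Finset.sum_congr rfl fun a _ => h𝔪 M a]
    rw [Finset.sum_const, nsmul_eq_mul]
    have h0 : (Fintype.card A : ℝ) ≠ 0 := by positivity
    have : ((Finset.univ.filter Q).card : ℝ) * (Fintype.card A : ℝ) ^ J.card
        = (Fintype.card A : ℝ) ^ M := by exact_mod_cast hcard
    rw [inv_pow, inv_pow, ← div_eq_mul_inv, div_eq_iff (by positivity), ← this]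
    field_simp
  · intro a _ b _ hab
    refine Set.disjoint_left.2 fun σ h1 h2 => hab ?_
    ext i
    rw [← h1 i, ← h2 i]
  · exact fun a _ => measurableSet_cyl a

/-- If the pair correlations of finitely many events exceed those of independent events by at most
`C` times the expected number of events, then it is unlikely that none of them occurs. -/
lemma measure_no_event_mul_le {Ω ι : Type*} [MeasurableSpace Ω] (P : Measure Ω)
    [IsProbabilityMeasure P] (T : Finset ι) (E : ι → Set Ω) (hE : ∀ i, MeasurableSet (E i)) (C : ℝ)
    (hC : ∑ i ∈ T, ∑ j ∈ T, P.real (E i ∩ E j) ≤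
      (∑ i ∈ T, P.real (E i)) ^ 2 + C * ∑ i ∈ T, P.real (E i)) :
    P.real {ω | ∀ i ∈ T, ω ∉ E i} * (∑ i ∈ T, P.real (E i)) ^ 2 ≤ C * ∑ i ∈ T, P.real (E i) := by
  set S := ∑ i ∈ T, P.real (E i) with hS
  set Y : Ω → ℝ := fun ω => ∑ i ∈ T, (E i).indicator 1 ω with hY
  have hint : ∀ s : Set Ω, MeasurableSet s → Integrable (s.indicator (1 : Ω → ℝ)) P :=
    fun s hs => (integrable_const (1 : ℝ)).indicator hs
  have hYi : Integrable Y P := integrable_finsetSum _ fun i _ => hint _ (hE i)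
  have hYsq : ∀ ω, Y ω ^ 2 = ∑ i ∈ T, ∑ j ∈ T, (E i ∩ E j).indicator (1 : Ω → ℝ) ω := by
    intro ω
    simp only [hY, sq, Finset.sum_mul_sum, Set.inter_indicator_one, Pi.mul_apply]
  have hY2i : Integrable (fun ω => Y ω ^ 2) P := by
    simp only [hYsq]
    exact integrable_finsetSum _ fun i _ => integrable_finsetSum _ fun j _ =>
      hint _ ((hE i).inter (hE j))
  have hYint : ∫ ω, Y ω ∂P = S := by
    simp only [hY]
    rw [integral_finsetSum _ fun i _ => hint _ (hE i)]
    exact Finset.sum_congr rfl fun i _ => integral_indicator_one (hE i)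
  have hY2int : ∫ ω, Y ω ^ 2 ∂P = ∑ i ∈ T, ∑ j ∈ T, P.real (E i ∩ E j) := by
    simp only [hYsq]
    rw [integral_finsetSum _ fun i _ => integrable_finsetSum _ fun j _ =>
      hint _ ((hE i).inter (hE j))]
    refine Finset.sum_congr rfl fun i _ => ?_
    rw [integral_finsetSum _ fun j _ => hint _ ((hE i).inter (hE j))]
    exact Finset.sum_congr rfl fun j _ => integral_indicator_one ((hE i).inter (hE j))
  set B : Set Ω := {ω | ∀ i ∈ T, ω ∉ E i} with hB
  have hBm : MeasurableSet B := by
    have : B = ⋂ i ∈ T, (E i)ᶜ := by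
      ext ω
      simp [hB]
    rw [this]
    exact Finset.measurableSet_biInter _ fun i _ => (hE i).compl
  have hle : ∫ ω, B.indicator (1 : Ω → ℝ) ω * S ^ 2 ∂P ≤
      ∫ ω, (Y ω ^ 2 - 2 * S * Y ω + S ^ 2) ∂P := by
    refine integral_mono ((hint B hBm).mul_const _)
      ((hY2i.sub (hYi.const_mul _)).add (integrable_const _)) fun ω => ?_
    by_cases hω : ω ∈ B
    · have : Y ω = 0 := Finset.sum_eq_zero fun i hi => by simp [hω i hi]
      simp [hω, this]
    · simp only [Set.indicator_of_notMem hω, zero_mul]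
      nlinarith [sq_nonneg (Y ω - S)]
  have hl : ∫ ω, B.indicator (1 : Ω → ℝ) ω * S ^ 2 ∂P = P.real B * S ^ 2 := by
    rw [integral_mul_const, integral_indicator_one hBm]
  have hr : ∫ ω, (Y ω ^ 2 - 2 * S * Y ω + S ^ 2) ∂P =
      ∑ i ∈ T, ∑ j ∈ T, P.real (E i ∩ E j) - 2 * S * S + S ^ 2 := by
    have h1 : Integrable (fun ω => Y ω ^ 2 - 2 * S * Y ω) P := hY2i.sub (hYi.const_mul _)
    rw [integral_add h1 (integrable_const _),
      integral_sub hY2i (hYi.const_mul _), integral_const_mul, hYint, hY2int]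
    simp
  rw [hl, hr] at hle
  nlinarith

/-- Sequences for which the `k` letters following position `n` continue the preceding ones with
period `p`. -/
def periodicBlock {A : Type*} (n p k : ℕ) : Set (ℕ → A) := coincide (Finset.Ico n (n + k)) (· - p)

lemma coincide_union {A : Type*} (J J' : Finset ℕ) (f : ℕ → ℕ) :
    (coincide (J ∪ J') f : Set (ℕ → A)) = coincide J f ∩ coincide J' f := by
  ext σ
  simp only [coincide, Finset.mem_union, Set.mem_inter_iff, Set.mem_ofPred_eq]
  exact ⟨fun h => ⟨fun j hj => h j (.inl hj), fun j hj => h j (.inr hj)⟩,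
    fun h j hj => hj.elim (h.1 j) (h.2 j)⟩

/-- Two periodic continuations with different, large periods can be rewritten as a system in which
every letter is prescribed at most once, by an earlier one. -/
lemma exists_coincide_eq_inter {A : Type*} {n m p q k k' : ℕ} (hnm : n ≤ m)
    (hp : n < 2 * p) (hpn : p ≤ n) (hq : m < 2 * q) (hqm : q ≤ m) (hpq : p ≠ q)
    (hk : 8 * k ≤ n) (hk' : 8 * k' ≤ m) :
    ∃ (J : Finset ℕ) (f : ℕ → ℕ), J.card = k + k' ∧ (∀ j ∈ J, f j < j) ∧
      (coincide J f : Set (ℕ → A)) = periodicBlock n p k ∩ periodicBlock m q k' := by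
  set U := Finset.Ico n (n + k) ∪ Finset.Ico m (m + k') with hU
  set I := Finset.Ico n (n + k) ∩ Finset.Ico m (m + k') with hI
  set a := min p q with ha
  set b := max p q with hb
  have hab : a < b := by omega
  have hbm : b ≤ m := by omega
  have hinj : Set.InjOn (· - a) (I : Set ℕ) := by
    intro x hx y hy hxy
    simp only [hI, Finset.coe_inter, Finset.coe_Ico, Set.mem_inter_iff, Set.mem_Ico] at hx hy hxy
    omega
  have hIlt : ∀ i ∈ I, i - a < n := by
    intro i hi
    simp only [hI, Finset.mem_inter, Finset.mem_Ico] at hi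
    omega
  have hdisj : Disjoint U (I.image (· - a)) := by
    rw [Finset.disjoint_left]
    intro j hj hj'
    obtain ⟨i, hi, rfl⟩ := Finset.mem_image.1 hj'
    have := hIlt i hi
    simp only [hU, Finset.mem_union, Finset.mem_Ico] at hj
    omega
  refine ⟨U ∪ I.image (· - a), fun j =>
    if j < n then j + a - b else if j < n + k then j - p else j - q, ?_, ?_, ?_⟩
  · rw [Finset.card_union_of_disjoint hdisj, Finset.card_image_of_injOn hinj,
      Finset.card_union_add_card_inter]
    simp
  · intro j hj
    rw [Finset.mem_union, Finset.mem_image] at hj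
    rcases hj with hj | ⟨i, hi, rfl⟩
    · simp only [hU, Finset.mem_union, Finset.mem_Ico] at hj
      beta_reduce
      split_ifs <;> omega
    · have := hIlt i hi
      simp only [hI, Finset.mem_inter, Finset.mem_Ico] at hi
      simp only [this, if_true]
      omega
  · ext σ
    constructor
    · intro h
      have h1 : ∀ j ∈ Finset.Ico n (n + k), σ j = σ (j - p) := by
        intro j hj
        have := h j (Finset.mem_union_left _ (Finset.mem_union_left _ hj))
        beta_reduce at this
        rw [Finset.mem_Ico] at hj
        rwa [if_neg (by omega), if_pos (by omega)] at this
      refine ⟨h1, fun j hj => ?_⟩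
      by_cases hjn : j < n + k
      · have hjI : j ∈ I := by
          simp only [hI, Finset.mem_inter, Finset.mem_Ico] at hj ⊢
          omega
        have h2 := h (j - a) (Finset.mem_union_right _ (Finset.mem_image_of_mem _ hjI))
        have h3 := h1 j (Finset.mem_inter.1 hjI).1
        beta_reduce at h2
        rw [if_pos (hIlt j hjI)] at h2
        rw [Finset.mem_Ico] at hj
        rw [show j - a + a - b = j - b by omega] at h2
        change σ j = σ (j - q)
        rcases lt_or_gt_of_ne hpq with hlt | hlt
        · rw [show a = p by omega, show b = q by omega] at h2
          exact h3.trans h2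
        · rw [show a = q by omega, show b = p by omega] at h2
          exact h3.trans h2.symm
      · have := h j (Finset.mem_union_left _ (Finset.mem_union_right _ hj))
        beta_reduce at this
        rw [Finset.mem_Ico] at hj
        rwa [if_neg (by omega), if_neg hjn] at this
    · rintro ⟨h1, h2⟩ j hj
      rw [Finset.mem_union, Finset.mem_image] at hj
      rcases hj with hj | ⟨i, hi, rfl⟩
      · simp only [hU, Finset.mem_union] at hj
        by_cases hj' : j < n + k
        · have hjn : ¬ j < n := by
            simp only [Finset.mem_Ico] at hj
            omega
          simp only [hjn, if_false, hj', if_true]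
          exact h1 j (Finset.mem_Ico.2 ⟨by omega, hj'⟩)
        · have hjn : ¬ j < n := by omega
          simp only [hjn, if_false, hj']
          exact h2 j (hj.resolve_left fun h => hj' (Finset.mem_Ico.1 h).2)
      · simp only [hIlt i hi, if_true]
        have h3 := h1 i (Finset.mem_inter.1 hi).1
        have h4 := h2 i (Finset.mem_inter.1 hi).2
        simp only at h3 h4
        simp only [hI, Finset.mem_inter, Finset.mem_Ico] at hi
        rw [show i - a + a - b = i - b by omega]
        rcases lt_or_gt_of_ne hpq with hlt | hlt
        · rw [show a = p by omega, show b = q by omega]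
          exact h3.symm.trans h4
        · rw [show a = q by omega, show b = p by omega]
          exact h4.symm.trans h3

section Bernoulli

variable {A : Type*} [Fintype A] [MeasurableSpace A] [MeasurableSingletonClass A]
  (𝔪 : Measure (ℕ → A)) [IsProbabilityMeasure 𝔪]

lemma measure_periodicBlock (hA : 0 < Fintype.card A)
    (h𝔪 : ∀ (n : ℕ) (a : Fin n → A), 𝔪.real (cyl a) = ((Fintype.card A : ℝ)⁻¹) ^ n)
    {n p k : ℕ} (hp : 0 < p) (hpn : p ≤ n) :
    𝔪.real (periodicBlock n p k) = ((Fintype.card A : ℝ)⁻¹) ^ k := by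
  rw [periodicBlock, measure_coincide 𝔪 hA h𝔪]
  · simp
  · intro j hj
    rw [Finset.mem_Ico] at hj
    omega

lemma measure_periodicBlock_inter_le_of_le (hA : 2 ≤ Fintype.card A)
    (h𝔪 : ∀ (n : ℕ) (a : Fin n → A), 𝔪.real (cyl a) = ((Fintype.card A : ℝ)⁻¹) ^ n)
    {n m p q k k' : ℕ} (hnm : n ≤ m)
    (hp : n < 2 * p) (hpn : p ≤ n) (hq : m < 2 * q) (hqm : q ≤ m)
    (hk : 8 * k ≤ n) (hk' : 8 * k' ≤ m) :
    𝔪.real (periodicBlock n p k ∩ periodicBlock m q k') ≤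
      ((Fintype.card A : ℝ)⁻¹) ^ k * ((Fintype.card A : ℝ)⁻¹) ^ k' +
        if p = q then (1 / 2 : ℝ) ^ (m - n) * ((Fintype.card A : ℝ)⁻¹) ^ k' else 0 := by
  have hu0 : 0 ≤ (Fintype.card A : ℝ)⁻¹ := by positivity
  have hu : (Fintype.card A : ℝ)⁻¹ ≤ 1 / 2 := by
    rw [one_div]
    exact inv_anti₀ (by norm_num) (by exact_mod_cast hA)
  by_cases hpq : p = q
  · subst hpq
    rw [if_pos rfl, periodicBlock, periodicBlock, ← coincide_union,
      measure_coincide 𝔪 (by omega) h𝔪 _ _ fun j hj => by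
        simp only [Finset.mem_union, Finset.mem_Ico] at hj
        omega]
    rcases le_or_gt (n + k) m with h | h
    · have hc : (Finset.Ico n (n + k) ∪ Finset.Ico m (m + k')).card = k + k' := by
        rw [Finset.card_union_of_disjoint]
        · simp
        · rw [Finset.disjoint_left]
          intro j hj hj'
          rw [Finset.mem_Ico] at hj hj'
          omega
      rw [hc, pow_add]
      exact le_add_of_nonneg_right (by positivity)
    · have hc : (m - n) + k' ≤ (Finset.Ico n (n + k) ∪ Finset.Ico m (m + k')).card := by
        have : Finset.Ico n (m + k') ⊆ Finset.Ico n (n + k) ∪ Finset.Ico m (m + k') := by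
          intro j hj
          simp only [Finset.mem_union, Finset.mem_Ico] at hj ⊢
          omega
        have := Finset.card_le_card this
        rw [Nat.card_Ico] at this
        omega
      calc ((Fintype.card A : ℝ)⁻¹) ^ (Finset.Ico n (n + k) ∪ Finset.Ico m (m + k')).card
          ≤ ((Fintype.card A : ℝ)⁻¹) ^ ((m - n) + k') :=
            pow_le_pow_of_le_one hu0 (by linarith) hc
        _ = ((Fintype.card A : ℝ)⁻¹) ^ (m - n) * ((Fintype.card A : ℝ)⁻¹) ^ k' := pow_add _ _ _
        _ ≤ (1 / 2 : ℝ) ^ (m - n) * ((Fintype.card A : ℝ)⁻¹) ^ k' := by gcongr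
        _ ≤ _ := le_add_of_nonneg_left (by positivity)
  · obtain ⟨J, f, hJ, hf, heq⟩ :=
      exists_coincide_eq_inter (A := A) hnm hp hpn hq hqm hpq hk hk'
    rw [← heq, measure_coincide 𝔪 (by omega) h𝔪 J f hf, hJ, if_neg hpq, pow_add, add_zero]

lemma measure_periodicBlock_inter_le (hA : 2 ≤ Fintype.card A)
    (h𝔪 : ∀ (n : ℕ) (a : Fin n → A), 𝔪.real (cyl a) = ((Fintype.card A : ℝ)⁻¹) ^ n)
    {n m p q k k' : ℕ}
    (hp : n < 2 * p) (hpn : p ≤ n) (hq : m < 2 * q) (hqm : q ≤ m)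
    (hk : 8 * k ≤ n) (hk' : 8 * k' ≤ m) :
    𝔪.real (periodicBlock n p k ∩ periodicBlock m q k') ≤
      ((Fintype.card A : ℝ)⁻¹) ^ k * ((Fintype.card A : ℝ)⁻¹) ^ k' +
        if p = q then (1 / 2 : ℝ) ^ ((m - n) + (n - m)) *
          (((Fintype.card A : ℝ)⁻¹) ^ k + ((Fintype.card A : ℝ)⁻¹) ^ k') else 0 := by
  have hu0 : 0 ≤ (Fintype.card A : ℝ)⁻¹ := by positivity
  rcases le_total n m with h | h
  · refine (measure_periodicBlock_inter_le_of_le 𝔪 hA h𝔪 h hp hpn hq hqm hk hk').trans ?_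
    rw [show (m - n) + (n - m) = m - n by omega]
    split_ifs
    · gcongr
      exact le_add_of_nonneg_left (pow_nonneg hu0 k)
    · exact le_rfl
  · rw [Set.inter_comm]
    refine (measure_periodicBlock_inter_le_of_le 𝔪 hA h𝔪 h hq hqm hp hpn hk' hk).trans ?_
    rw [show (m - n) + (n - m) = n - m by omega, mul_comm]
    simp only [eq_comm (a := q)]
    split_ifs
    · gcongr
      exact le_add_of_nonneg_right (pow_nonneg hu0 k')
    · exact le_rfl

lemma sum_half_pow_dist_le (F : Finset ℕ) (n : ℕ) :
    ∑ m ∈ F, (1 / 2 : ℝ) ^ ((m - n) + (n - m)) ≤ 4 := by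
  have key : ∀ (F : Finset ℕ) (h : ℕ → ℕ), Set.InjOn h F → ∑ m ∈ F, (1 / 2 : ℝ) ^ h m ≤ 2 := by
    intro F h hinj
    rw [← Finset.sum_image (f := fun x => (1 / 2 : ℝ) ^ x) hinj]
    exact (summable_geometric_two.sum_le_tsum _ fun i _ => by positivity).trans_eq
      tsum_geometric_two
  rw [← Finset.sum_filter_add_sum_filter_not F (fun m => m ≤ n)]
  have h1 := key (F.filter fun m => m ≤ n) (fun m => (m - n) + (n - m)) (by
    intro x hx y hy hxy
    simp only [Finset.coe_filter, Set.mem_ofPred_eq] at hx hy hxy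
    omega)
  have h2 := key (F.filter fun m => ¬ m ≤ n) (fun m => (m - n) + (n - m)) (by
    intro x hx y hy hxy
    simp only [Finset.coe_filter, Set.mem_ofPred_eq] at hx hy hxy
    omega)
  linarith

/-- For a set `F` of lengths, the second moment bound for the number of periodic continuations. -/
lemma measure_no_periodicBlock_mul_le (hA : 2 ≤ Fintype.card A)
    (h𝔪 : ∀ (n : ℕ) (a : Fin n → A), 𝔪.real (cyl a) = ((Fintype.card A : ℝ)⁻¹) ^ n)
    (k : ℕ → ℕ) (F : Finset ℕ) (hF : ∀ n ∈ F, 8 * k n ≤ n) :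
    𝔪.real {σ | ∀ n ∈ F, ∀ p ∈ Finset.Ioc (n / 2) n, σ ∉ periodicBlock n p (k n)} *
      (∑ n ∈ F, (Finset.Ioc (n / 2) n).card * ((Fintype.card A : ℝ)⁻¹) ^ k n) ^ 2 ≤
      8 * ∑ n ∈ F, (Finset.Ioc (n / 2) n).card * ((Fintype.card A : ℝ)⁻¹) ^ k n := by
  set u := (Fintype.card A : ℝ)⁻¹ with hu
  have hu0 : 0 ≤ u := by positivity
  set T : Finset (Σ _ : ℕ, ℕ) := F.sigma fun n => Finset.Ioc (n / 2) n with hT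
  set E : (Σ _ : ℕ, ℕ) → Set (ℕ → A) := fun i => periodicBlock i.1 i.2 (k i.1) with hE
  have hTmem : ∀ i ∈ T, i.1 < 2 * i.2 ∧ i.2 ≤ i.1 ∧ 8 * k i.1 ≤ i.1 := by
    intro i hi
    simp only [hT, Finset.mem_sigma, Finset.mem_Ioc] at hi
    exact ⟨by omega, hi.2.2, hF _ hi.1⟩
  have hP : ∀ i ∈ T, 𝔪.real (E i) = u ^ k i.1 := fun i hi =>
    measure_periodicBlock 𝔪 (by omega) h𝔪 (by have := hTmem i hi; omega) (hTmem i hi).2.1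
  have hS : ∑ i ∈ T, 𝔪.real (E i) = ∑ n ∈ F, (Finset.Ioc (n / 2) n).card * u ^ k n := by
    rw [Finset.sum_congr rfl hP, hT, Finset.sum_sigma]
    simp only [Finset.sum_const, nsmul_eq_mul]
  have hset : {σ : ℕ → A | ∀ n ∈ F, ∀ p ∈ Finset.Ioc (n / 2) n, σ ∉ periodicBlock n p (k n)} =
      {σ | ∀ i ∈ T, σ ∉ E i} := by
    ext σ
    simp only [Set.mem_ofPred_eq, hT, Finset.mem_sigma]
    exact ⟨fun h i hi => h i.1 hi.1 i.2 hi.2, fun h n hn p hp => h ⟨n, p⟩ ⟨hn, hp⟩⟩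
  rw [hset, ← hS]
  refine measure_no_event_mul_le 𝔪 T E (fun i => measurableSet_coincide _ _) 8 ?_
  set w : (Σ _ : ℕ, ℕ) → (Σ _ : ℕ, ℕ) → ℝ := fun i j =>
    if i.2 = j.2 then (1 / 2 : ℝ) ^ ((j.1 - i.1) + (i.1 - j.1)) else 0 with hw
  have hwsymm : ∀ i j, w i j = w j i := by
    intro i j
    simp only [hw, eq_comm (a := i.2), add_comm (j.1 - i.1)]
  have hwsum : ∀ i, ∑ j ∈ T, w i j ≤ 4 := by
    intro i
    rw [hw, ← Finset.sum_filter]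
    have hinj : Set.InjOn (fun j : Σ _ : ℕ, ℕ => j.1) (T.filter fun j => i.2 = j.2) := by
      rintro ⟨x, p⟩ hx ⟨y, q⟩ hy hxy
      simp only [Finset.coe_filter, Set.mem_ofPred_eq] at hx hy hxy
      obtain rfl := hxy
      rw [← hx.2, ← hy.2]
    rw [← Finset.sum_image (f := fun m => (1 / 2 : ℝ) ^ ((m - i.1) + (i.1 - m))) hinj]
    exact sum_half_pow_dist_le _ _
  calc ∑ i ∈ T, ∑ j ∈ T, 𝔪.real (E i ∩ E j)
      ≤ ∑ i ∈ T, ∑ j ∈ T, (𝔪.real (E i) * 𝔪.real (E j) +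
          (𝔪.real (E i) * w i j + 𝔪.real (E j) * w j i)) := by
        refine Finset.sum_le_sum fun i hi => Finset.sum_le_sum fun j hj => ?_
        obtain ⟨h1, h2, h3⟩ := hTmem i hi
        obtain ⟨h4, h5, h6⟩ := hTmem j hj
        refine (measure_periodicBlock_inter_le 𝔪 hA h𝔪 h1 h2 h4 h5 h3 h6).trans (le_of_eq ?_)
        rw [hP i hi, hP j hj, hwsymm j i]
        simp only [hw]
        split_ifs <;> ring
    _ = (∑ i ∈ T, 𝔪.real (E i)) ^ 2 + 2 * ∑ i ∈ T, 𝔪.real (E i) * ∑ j ∈ T, w i j := by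
        simp only [Finset.sum_add_distrib]
        rw [sq, Finset.sum_mul_sum, Finset.sum_comm (f := fun i j => 𝔪.real (E j) * w j i)]
        rw [two_mul]
        simp only [Finset.mul_sum]
    _ ≤ (∑ i ∈ T, 𝔪.real (E i)) ^ 2 + 2 * ∑ i ∈ T, 𝔪.real (E i) * 4 := by
        gcongr with i hi
        exact hwsum i
    _ = _ := by
        rw [← Finset.sum_mul]
        ring

/-- The divergence Borel–Cantelli statement for periodic continuations. -/
theorem ae_frequently_periodicBlock (hA : 2 ≤ Fintype.card A)
    (h𝔪 : ∀ (n : ℕ) (a : Fin n → A), 𝔪.real (cyl a) = ((Fintype.card A : ℝ)⁻¹) ^ n)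
    (k : ℕ → ℕ) (G : Set ℕ) (hG : ∀ n ∈ G, 8 * k n ≤ n)
    (hdiv : ¬ Summable (G.indicator fun n : ℕ => (n : ℝ) * ((Fintype.card A : ℝ)⁻¹) ^ k n)) :
    ∀ᵐ σ ∂𝔪, ∃ᶠ n in atTop, n ∈ G ∧ ∃ p, 0 < p ∧ p ≤ n ∧ σ ∈ periodicBlock n p (k n) := by
  classical
  set u := (Fintype.card A : ℝ)⁻¹ with hu
  have hu0 : 0 ≤ u := by positivity
  set h : ℕ → ℝ := G.indicator fun n : ℕ => (n : ℝ) * u ^ k n with hh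
  have hh0 : ∀ n, 0 ≤ h n := fun n => Set.indicator_nonneg (fun n _ => by positivity) n
  have htend := (not_summable_iff_tendsto_nat_atTop_of_nonneg hh0).1 hdiv
  simp only [frequently_atTop, ae_all_iff]
  intro n₀
  set Z : Set (ℕ → A) := {σ | ∀ n, n₀ ≤ n → n ∈ G →
    ∀ p ∈ Finset.Ioc (n / 2) n, σ ∉ periodicBlock n p (k n)} with hZ
  have hZ0 : 𝔪.real Z = 0 := by
    refine le_antisymm (le_of_forall_pos_le_add fun ε hε => ?_) measureReal_nonneg
    obtain ⟨M, hM⟩ := (htend.eventually_ge_atTop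
      (2 * (8 / ε + 1) + ∑ n ∈ Finset.range n₀, h n)).exists
    set F : Finset ℕ := (Finset.range M).filter fun n => n₀ ≤ n ∧ n ∈ G with hF
    set S := ∑ n ∈ F, (Finset.Ioc (n / 2) n).card * u ^ k n with hS
    have hSlow : 8 / ε + 1 ≤ S := by
      have h1 : ∑ n ∈ Finset.range M, h n ≤ ∑ n ∈ Finset.range n₀, h n + ∑ n ∈ F, h n := by
        have hsub : ∀ n ∈ Finset.range M, n ∉ Finset.range n₀ ∪ F → h n = 0 := by
          intro n hn hn'
          simp only [hF, Finset.mem_union, Finset.mem_range, Finset.mem_filter, not_or] at hn hn'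
          exact Set.indicator_of_notMem (fun hnG => hn'.2 ⟨hn, by omega, hnG⟩) _
        calc ∑ n ∈ Finset.range M, h n
            ≤ ∑ n ∈ Finset.range M ∪ (Finset.range n₀ ∪ F), h n :=
              Finset.sum_le_sum_of_subset_of_nonneg Finset.subset_union_left fun n _ _ => hh0 n
          _ = ∑ n ∈ Finset.range n₀ ∪ F, h n := by
              refine (Finset.sum_subset Finset.subset_union_right fun n hn hn' => ?_).symm
              exact hsub n ((Finset.mem_union.1 hn).resolve_right hn') hn'
          _ ≤ ∑ n ∈ Finset.range n₀ ∪ F, h n + ∑ n ∈ Finset.range n₀ ∩ F, h n :=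
              le_add_of_nonneg_right (Finset.sum_nonneg fun n _ => hh0 n)
          _ = _ := Finset.sum_union_inter
      have h2 : ∑ n ∈ F, h n ≤ 2 * S := by
        rw [hS, Finset.mul_sum]
        refine Finset.sum_le_sum fun n hn => ?_
        rw [hh, Set.indicator_of_mem (Finset.mem_filter.1 hn).2.2, ← mul_assoc]
        gcongr
        rw [Nat.card_Ioc]
        exact_mod_cast (by omega : n ≤ 2 * (n - n / 2))
      linarith
    have hSpos : 0 < S := lt_of_lt_of_le (by positivity) hSlow
    have hmain := measure_no_periodicBlock_mul_le 𝔪 hA h𝔪 k F fun n hn =>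
      hG n (Finset.mem_filter.1 hn).2.2
    have hsub : 𝔪.real Z ≤
        𝔪.real {σ | ∀ n ∈ F, ∀ p ∈ Finset.Ioc (n / 2) n, σ ∉ periodicBlock n p (k n)} := by
      refine measureReal_mono fun σ hσ n hn => ?_
      have := (Finset.mem_filter.1 hn).2
      exact hσ n this.1 this.2
    have h3 : 𝔪.real Z * S ≤ 8 := by
      refine le_of_mul_le_mul_right ?_ hSpos
      calc 𝔪.real Z * S * S = 𝔪.real Z * S ^ 2 := by ring
        _ ≤ 8 * S := (mul_le_mul_of_nonneg_right hsub (sq_nonneg S)).trans hmain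
    have h4 : 8 ≤ ε * S := by
      have : ε * (8 / ε + 1) ≤ ε * S := by gcongr
      rw [mul_add, mul_div_cancel₀ _ hε.ne'] at this
      linarith
    rw [zero_add]
    exact le_of_mul_le_mul_right (h3.trans h4) hSpos
  have hZ0' : 𝔪 Z = 0 := by simpa [measureReal_eq_zero_iff] using hZ0
  filter_upwards [measure_eq_zero_iff_ae_notMem.1 hZ0'] with σ hσ
  simp only [hZ, Set.mem_ofPred_eq, not_forall, not_not] at hσ
  obtain ⟨n, hn, hnG, p, hp, hσp⟩ := hσ
  rw [Finset.mem_Ioc] at hp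
  exact ⟨n, hn, hnG, p, by omega, hp.2, hσp⟩

end Bernoulli

lemma evp_eq_of_mem_periodicBlock {A : Type*} {σ : ℕ → A} {n p k : ℕ} (hp : 0 < p) (hpn : p ≤ n)
    (hσ : σ ∈ periodicBlock n p k) (h : n - p < n) (i : ℕ) (hi : i < n + k) :
    evp (fun j : Fin n => σ j) (n - p) h i = σ i := by
  induction i using Nat.strong_induction_on with
  | _ i ih =>
    by_cases h1 : i < n - p
    · simp [evp, h1]
    by_cases h2 : i < n
    · simp only [evp, h1, dif_neg, not_false_eq_true]
      rw [Nat.mod_eq_of_lt (by omega)]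
      congr 1
      omega
    · have h3 : ¬ i - p < n - p := by omega
      have hprev := ih (i - p) (by omega) (by omega)
      have hstep : σ i = σ (i - p) := hσ i (Finset.mem_Ico.2 ⟨by omega, hi⟩)
      rw [hstep, ← hprev]
      simp only [evp, h1, h3, dif_neg, not_false_eq_true]
      have : (i - (n - p)) % (n - (n - p)) = (i - p - (n - p)) % (n - (n - p)) := by
        rw [show i - (n - p) = (i - p - (n - p)) + (n - (n - p)) by omega, Nat.add_mod_right]
      rw [this]

lemma diam_image_of_norm_sub_eq {E : Type*} [NormedAddCommGroup E] {f : E → E} {c : ℝ} (hc : 0 < c)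
    (hf : ∀ x y, ‖f x - f y‖ = c * ‖x - y‖) {X : Set E} (hX : Bornology.IsBounded X) :
    Metric.diam (f '' X) = c * Metric.diam X := by
  have hle : ∀ x ∈ X, ∀ y ∈ X, ‖f x - f y‖ ≤ c * Metric.diam X := fun x hx y hy => by
    rw [hf, ← dist_eq_norm]
    gcongr
    exact Metric.dist_le_diam_of_mem hX hx hy
  have hbdd : Bornology.IsBounded (f '' X) := by
    refine Metric.isBounded_iff.2 ⟨c * Metric.diam X, ?_⟩
    rintro _ ⟨x, hx, rfl⟩ _ ⟨y, hy, rfl⟩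
    rw [dist_eq_norm]
    exact hle x hx y hy
  apply le_antisymm
  · refine Metric.diam_le_of_forall_dist_le (by positivity) ?_
    rintro _ ⟨x, hx, rfl⟩ _ ⟨y, hy, rfl⟩
    rw [dist_eq_norm]
    exact hle x hx y hy
  · rw [← le_div_iff₀' hc]
    refine Metric.diam_le_of_forall_dist_le (by positivity) fun x hx y hy => ?_
    rw [le_div_iff₀' hc, dist_eq_norm, ← hf, ← dist_eq_norm]
    exact Metric.dist_le_diam_of_mem hbdd (Set.mem_image_of_mem f hx) (Set.mem_image_of_mem f hy)

lemma norm_iterMap_sub {A E : Type*} [NormedAddCommGroup E] {φ : A → E → E} {ρ : ℝ}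
    (hsim : ∀ a x y, ‖φ a x - φ a y‖ = ρ * ‖x - y‖) {n : ℕ} (a : Fin n → A) (x y : E) :
    ‖iterMap φ a x - iterMap φ a y‖ = ρ ^ n * ‖x - y‖ := by
  induction n with
  | zero => simp [iterMap]
  | succ n ih =>
    have hcons : ∀ z, iterMap φ a z = φ (a 0) (iterMap φ (fun i : Fin n => a i.succ) z) := by
      intro z
      simp [iterMap, List.ofFn_succ]
    rw [hcons, hcons, hsim, ih, pow_succ]
    ring

lemma norm_coding_sub_le {A E : Type*} [NormedAddCommGroup E] {φ : A → E → E} {ρ : ℝ} (hρ : 0 ≤ ρ)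
    (hsim : ∀ a x y, ‖φ a x - φ a y‖ = ρ * ‖x - y‖) {X : Set E} (hX : Bornology.IsBounded X)
    {n : ℕ} (a : Fin n → A) {x y : E} (hx : x ∈ iterMap φ a '' X) (hy : y ∈ iterMap φ a '' X) :
    ‖x - y‖ ≤ ρ ^ n * Metric.diam X := by
  obtain ⟨x, hx, rfl⟩ := hx
  obtain ⟨y, hy, rfl⟩ := hy
  rw [norm_iterMap_sub hsim, ← dist_eq_norm]
  gcongr
  exact Metric.dist_le_diam_of_mem hX hx hy

lemma measurable_coding {A E : Type*} [Finite A] [MeasurableSpace A] [MeasurableSingletonClass A]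
    [NormedAddCommGroup E] [MeasurableSpace E] [BorelSpace E] {φ : A → E → E} {ρ : ℝ}
    (hρ : ρ ∈ Set.Ioo (0 : ℝ) 1) (hsim : ∀ a x y, ‖φ a x - φ a y‖ = ρ * ‖x - y‖)
    {X : Set E} (hX : Bornology.IsBounded X) (hXne : X.Nonempty) {π : (ℕ → A) → E}
    (hπ : ∀ (σ : ℕ → A) (n : ℕ), π σ ∈ iterMap φ (fun i : Fin n => σ i) '' X) :
    Measurable π := by
  obtain ⟨x₀, hx₀⟩ := hXne
  refine measurable_of_tendsto_metrizable
    (f := fun n σ => iterMap φ (fun i : Fin n => σ i) x₀) (fun n => ?_) ?_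
  · have h1 : Measurable fun a : Fin n → A => iterMap φ a x₀ := measurable_of_countable _
    exact h1.comp (measurable_pi_lambda _ fun i => measurable_pi_apply _)
  · rw [tendsto_pi_nhds]
    intro σ
    rw [tendsto_iff_norm_sub_tendsto_zero]
    have hlim : Tendsto (fun n : ℕ => ρ ^ n * Metric.diam X) atTop (nhds 0) := by
      simpa using (tendsto_pow_atTop_nhds_zero_of_lt_one hρ.1.le hρ.2).mul_const (Metric.diam X)
    exact squeeze_zero (fun _ => norm_nonneg _) (fun n => norm_coding_sub_le hρ.1.le hsim hX _
      (Set.mem_image_of_mem _ hx₀) (hπ σ n)) hlim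

/-- The thresholds `g n` can be replaced by powers `ρ ^ k n < g n`, keeping divergence of the
series, where `k n` may moreover be taken at most `n / 8`. -/
lemma exists_exponent_not_summable {ρ s N : ℝ} (hρ : ρ ∈ Set.Ioo (0 : ℝ) 1) (hs : 0 < s)
    (hN : 1 < N) (hρs : ρ ^ s = N⁻¹) {g : ℕ → ℝ} (hg : ∀ n, 0 ≤ g n)
    (hdiv : ¬ Summable fun n : ℕ => (n : ℝ) * g n ^ s) :
    ∃ (k : ℕ → ℕ) (G : Set ℕ), (∀ n ∈ G, 8 * k n ≤ n) ∧ (∀ n ∈ G, ρ ^ k n < g n) ∧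
      ¬ Summable (G.indicator fun n : ℕ => (n : ℝ) * (N⁻¹) ^ k n) := by
  classical
  have hN0 : 0 < N := by linarith
  have hu1 : N⁻¹ < 1 := inv_lt_one_of_one_lt₀ hN
  have hex : ∀ n, ∃ k : ℕ, 0 < g n → ρ ^ k < g n ∧ (k = 0 ∨ g n ≤ ρ ^ (k - 1)) := by
    intro n
    by_cases hgn : 0 < g n
    · have h := exists_pow_lt_of_lt_one hgn hρ.2
      refine ⟨Nat.find h, fun _ => ⟨Nat.find_spec h, ?_⟩⟩
      rcases Nat.eq_zero_or_pos (Nat.find h) with h0 | h0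
      · exact .inl h0
      · exact .inr (not_lt.1 (Nat.find_min h (by omega)))
    · exact ⟨0, fun h => absurd h hgn⟩
  choose k hk using hex
  refine ⟨k, {n | 0 < g n ∧ 8 * k n ≤ n}, fun n hn => hn.2, fun n hn => (hk n hn.1).1,
    fun hsum => hdiv ?_⟩
  -- the lengths with a large exponent contribute a convergent series
  have htail : Summable fun n : ℕ => (n : ℝ) * (N⁻¹) ^ (n / 8) := by
    obtain ⟨v, hv0, hv1, hv8⟩ : ∃ v : ℝ, 0 < v ∧ v < 1 ∧ v ^ 8 = N⁻¹ := by
      refine ⟨(N⁻¹) ^ (1 / 8 : ℝ), by positivity,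
        Real.rpow_lt_one (by positivity) hu1 (by norm_num), ?_⟩
      rw [← Real.rpow_natCast, ← Real.rpow_mul (by positivity)]
      norm_num
    have hv : ‖v‖ < 1 := by rwa [Real.norm_of_nonneg hv0.le]
    have hgeo := (summable_pow_mul_geometric_of_norm_lt_one 1 hv).mul_left N
    refine Summable.of_nonneg_of_le (fun n => by positivity) (fun n => ?_) hgeo
    rw [pow_one, mul_left_comm]
    gcongr
    calc (N⁻¹) ^ (n / 8) = N * (N⁻¹) ^ (n / 8 + 1) := by
          rw [pow_succ]
          field_simp
      _ = N * v ^ (8 * (n / 8 + 1)) := by rw [← hv8, pow_mul]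
      _ ≤ N * v ^ n := by
          gcongr N * ?_
          exact pow_le_pow_of_le_one hv0.le hv1.le (by omega)
  set h : ℕ → ℝ := {n | 0 < g n}.indicator fun n : ℕ => (n : ℝ) * (N⁻¹) ^ k n with hh
  have hh0 : ∀ n, 0 ≤ h n := fun n => Set.indicator_nonneg (fun n _ => by positivity) n
  have hhsum : Summable h := by
    refine Summable.of_nonneg_of_le hh0 (fun n => ?_) (hsum.add htail)
    by_cases hgn : 0 < g n
    · rw [hh, Set.indicator_of_mem (by exact hgn)]
      by_cases hkn : 8 * k n ≤ n
      · rw [Set.indicator_of_mem (by exact ⟨hgn, hkn⟩)]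
        exact le_add_of_nonneg_right (by positivity)
      · rw [Set.indicator_of_notMem (fun hn => hkn hn.2), zero_add]
        gcongr (n : ℝ) * ?_
        exact pow_le_pow_of_le_one (by positivity) hu1.le (by omega)
    · rw [hh, Set.indicator_of_notMem (by exact hgn)]
      exact add_nonneg (Set.indicator_nonneg (fun n _ => by positivity) n) (by positivity)
  have hsmall : ∀ᶠ n in atTop, h n < 1 :=
    hhsum.tendsto_atTop_zero.eventually_lt_const one_pos
  refine Summable.of_norm_bounded_eventually_nat (hhsum.mul_left N) ?_
  filter_upwards [hsmall, eventually_ge_atTop 1] with n hn hn1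
  rw [Real.norm_of_nonneg (mul_nonneg n.cast_nonneg (Real.rpow_nonneg (hg n) s))]
  rcases (hg n).eq_or_lt with hgn | hgn
  · rw [← hgn, Real.zero_rpow hs.ne', mul_zero]
    exact mul_nonneg hN0.le (hh0 n)
  · have hval : h n = (n : ℝ) * (N⁻¹) ^ k n := Set.indicator_of_mem (by exact hgn) _
    have hk0 : k n ≠ 0 := by
      intro h0
      rw [hval, h0, pow_zero, mul_one] at hn
      have : (1 : ℝ) ≤ n := by exact_mod_cast hn1
      linarith
    have hle : g n ≤ ρ ^ (k n - 1) := (hk n hgn).2.resolve_left hk0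
    have hpow : g n ^ s ≤ (N⁻¹) ^ (k n - 1) := by
      calc g n ^ s ≤ (ρ ^ (k n - 1)) ^ s := Real.rpow_le_rpow hgn.le hle hs.le
        _ = (N⁻¹) ^ (k n - 1) := by
          rw [← hρs, ← Real.rpow_natCast, ← Real.rpow_natCast, ← Real.rpow_mul hρ.1.le,
            ← Real.rpow_mul hρ.1.le, mul_comm]
    calc (n : ℝ) * g n ^ s ≤ n * (N⁻¹) ^ (k n - 1) := by gcongr
      _ = N * h n := by
        rw [hval, ← Nat.sub_one_add_one hk0, pow_succ]
        simp only [Nat.add_sub_cancel]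
        field_simp

/-- Theorem 1.1(3) of the paper: for an equicontractive IFS and any
`g : ℕ → [0,∞)` with `Σ_n Σ_{a∈A^n} n·(diam(X_a)·g(n))^{dim_S Φ} = ∞`, letting
`Ψ(a) = diam(X_a)·g(|a|)`, the self-similar measure `μ = π_*𝔪` gives `μ(W_Φ(Ψ)) = 1`. -/
theorem statement2 {d : ℕ} {A : Type*} [Fintype A] [MeasurableSpace A]
    [MeasurableSingletonClass A]
    (hA : 2 ≤ Fintype.card A)
    (φ : A → EuclideanSpace ℝ (Fin d) → EuclideanSpace ℝ (Fin d))
    (r : A → ℝ) (hr : ∀ a, r a ∈ Set.Ioo (0 : ℝ) 1)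
    (hsim : ∀ a x y, ‖φ a x - φ a y‖ = r a * ‖x - y‖)
    -- the IFS is equicontractive
    (hequi : ∀ a b, r a = r b)
    (X : Set (EuclideanSpace ℝ (Fin d)))
    (hXne : X.Nonempty) (hXcomp : IsCompact X)
    (hXinv : X = ⋃ a, φ a '' X)
    (π : (ℕ → A) → EuclideanSpace ℝ (Fin d))
    (hπ : ∀ (σ : ℕ → A) (n : ℕ), π σ ∈ iterMap φ (fun i : Fin n => σ i) '' X)
    -- the similarity dimension
    (sdim : ℝ) (hsdim : 0 < sdim) (hsum1 : ∑ a : A, r a ^ sdim = 1)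
    -- the Bernoulli measure `𝔪` with marginal `p`, `p_a = r_a ^ sdim`
    (𝔪 : Measure (ℕ → A)) [IsProbabilityMeasure 𝔪]
    (h𝔪 : ∀ (n : ℕ) (a : Fin n → A), 𝔪 (cyl a) = ENNReal.ofReal (∏ i, r (a i) ^ sdim))
    (g : ℕ → ℝ) (hg0 : ∀ n, 0 ≤ g n)
    (hdiv : ¬ Summable fun n : ℕ =>
      ∑ a : Fin n → A, (n : ℝ) * (Metric.diam (iterMap φ a '' X) * g n) ^ sdim) :
    Measure.map π 𝔪 (limsupW π (fun n a => Metric.diam (iterMap φ a '' X) * g n)) = 1 := by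
  have hN : (1 : ℝ) < Fintype.card A := by exact_mod_cast hA
  obtain ⟨a₀⟩ : Nonempty A := Fintype.card_pos_iff.1 (by omega)
  obtain ⟨ρ, hrρ⟩ : ∃ ρ, ∀ a, r a = ρ := ⟨r a₀, fun a => hequi a a₀⟩
  have hρ : ρ ∈ Set.Ioo (0 : ℝ) 1 := hrρ a₀ ▸ hr a₀
  simp only [hrρ] at hsim hsum1 h𝔪
  have hρs : ρ ^ sdim = (Fintype.card A : ℝ)⁻¹ := by
    rw [Finset.sum_const, Finset.card_univ, nsmul_eq_mul] at hsum1
    exact eq_inv_of_mul_eq_one_right hsum1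
  have hcyl : ∀ (n : ℕ) (a : Fin n → A), 𝔪.real (cyl a) = ((Fintype.card A : ℝ)⁻¹) ^ n := by
    intro n a
    rw [measureReal_def, h𝔪, ENNReal.toReal_ofReal (Finset.prod_nonneg fun _ _ =>
      Real.rpow_nonneg hρ.1.le _)]
    simp [hρs]
  have hXb := hXcomp.isBounded
  set D := Metric.diam X with hD
  have hdiam : ∀ (n : ℕ) (a : Fin n → A), Metric.diam (iterMap φ a '' X) = ρ ^ n * D :=
    fun n a => diam_image_of_norm_sub_eq (pow_pos hρ.1 n) (norm_iterMap_sub hsim a) hXb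
  have hterm : ∀ n : ℕ, ∑ a : Fin n → A,
      (n : ℝ) * (Metric.diam (iterMap φ a '' X) * g n) ^ sdim =
        D ^ sdim * ((n : ℝ) * g n ^ sdim) := by
    intro n
    have hD0 : 0 ≤ D := Metric.diam_nonneg
    have hρn : (ρ ^ n) ^ sdim = ((Fintype.card A : ℝ)⁻¹) ^ n := by
      rw [← hρs, ← Real.rpow_natCast, ← Real.rpow_natCast, ← Real.rpow_mul hρ.1.le,
        ← Real.rpow_mul hρ.1.le, mul_comm]
    simp only [hdiam]
    rw [Real.mul_rpow (mul_nonneg (pow_nonneg hρ.1.le n) hD0) (hg0 n),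
      Real.mul_rpow (pow_nonneg hρ.1.le n) hD0, hρn]
    simp only [Finset.sum_const, Finset.card_univ, Fintype.card_fun, Fintype.card_fin,
      nsmul_eq_mul, Nat.cast_pow, inv_pow]
    field_simp
  simp only [hterm] at hdiv
  have hDpos : 0 < D := by
    refine lt_of_le_of_ne Metric.diam_nonneg fun h0 => hdiv ?_
    simp only [← h0, Real.zero_rpow hsdim.ne', zero_mul]
    exact summable_zero
  obtain ⟨k, G, hG, hGg, hGdiv⟩ := exists_exponent_not_summable hρ hsdim hN hρs hg0
    fun h => hdiv (h.mul_left _)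
  have hmeas : Measurable π := measurable_coding hρ hsim hXb hXne hπ
  have : IsProbabilityMeasure (Measure.map π 𝔪) :=
    Measure.isProbabilityMeasure_map hmeas.aemeasurable
  have hfull : 𝔪 (π ⁻¹' limsupW π fun n a => Metric.diam (iterMap φ a '' X) * g n) = 1 := by
    rw [← measure_univ (μ := 𝔪)]
    refine measure_congr (eventuallyEq_univ.2 ?_)
    filter_upwards [ae_frequently_periodicBlock 𝔪 hA hcyl k G hG hGdiv] with σ hσ
    refine hσ.mono ?_
    rintro n ⟨hnG, p, hp, hpn, hσp⟩
    have hl : n - p < n := by omega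
    refine ⟨fun i => σ i, n - p, hl, ?_⟩
    have hword : (fun i : Fin (n + k n) => evp (fun j : Fin n => σ j) (n - p) hl i) =
        fun i : Fin (n + k n) => σ i :=
      funext fun i => evp_eq_of_mem_periodicBlock hp hpn hσp hl i i.isLt
    have hτ := hπ (evp (fun j : Fin n => σ j) (n - p) hl) (n + k n)
    rw [hword] at hτ
    calc ‖π σ - π (evp (fun j : Fin n => σ j) (n - p) hl)‖
        ≤ ρ ^ (n + k n) * D := norm_coding_sub_le hρ.1.le hsim hXb _ (hπ σ _) hτ
      _ = ρ ^ n * D * ρ ^ k n := by ring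
      _ < ρ ^ n * D * g n :=
        mul_lt_mul_of_pos_left (hGg n hnG) (mul_pos (pow_pos hρ.1 n) hDpos)
      _ = Metric.diam (iterMap φ (fun i : Fin n => σ i) '' X) * g n := by rw [hdiam]
  exact le_antisymm prob_le_one (hfull ▸ Measure.le_map_apply hmeas.aemeasurable _)
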